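/- For 0 < q < 1 and r ∈ ℤ, the inverse q-Hankel pair holds: if f ∈ ℓ²(q^ℤ) and g(q^n) = Σ_{k∈ℤ} q^{2k} J_ν(q^{k+n}; q²) f(q^k), then f(q^k) = Σ_{n∈ℤ} q^{2n} J_ν(q^{k+n}; q²) g(q^n); i.e., the q-Hankel transform with kernel J_ν is a self-inverse unitary operator on ℓ²(ℤ) (with weights q^{2k}). -/

import Mathlib

/-- The finite q-shifted factorial `(a;q)_k`. -/
noncomputable def qp (q a : ℝ) (k : ℕ) : ℝ := ∏ i ∈ Finset.range k, (1 - a * q ^ i)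

/-- The infinite q-shifted factorial `(a;q)_∞`. -/
noncomputable def qpInf (q a : ℝ) : ℝ := ∏' i : ℕ, (1 - a * q ^ i)

/-- The Wall polynomial `p_n(x;a;q) = ₂φ₁(q^{-n},0;aq;q,qx)` as a terminating sum. -/
noncomputable def wall (n : ℕ) (x a q : ℝ) : ℝ :=
  ∑ j ∈ Finset.range (n + 1), qp q (q ^ (-(n : ℤ))) j / (qp q (a * q) j * qp q q j) * (q * x) ^ j
/-- The `₁φ₁` q-Bessel function `J_ν(x;q²)` of real order `ν` and positive real argument,
in the combined form
`x^ν (q²;q²)_∞⁻¹ Σ_k (-1)^k q^{k(k-1)} (q²x²)^k (q^{2ν+2+2k};q²)_∞ / (q²;q²)_k`. -/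
noncomputable def Jr (q ν x : ℝ) : ℝ :=
  x ^ ν * (∑' k : ℕ, (-1) ^ k * q ^ (k * (k - 1)) * (q ^ 2 * x ^ 2) ^ k *
      qpInf (q ^ 2) (q ^ (2 * ν + 2 + 2 * (k : ℝ))) / qp (q ^ 2) (q ^ 2) k) /
    qpInf (q ^ 2) (q ^ 2)

/-! ### Euler's q-exponential series -/

/-- The coefficients `1 / (Q;Q)_k` of `1 / (x;Q)_∞`. -/
noncomputable def smallCoeff (Q : ℝ) (k : ℕ) : ℝ := 1 / qp Q Q k

/-- The coefficients `(-1)^k Q^{k(k-1)/2} / (Q;Q)_k` of `(x;Q)_∞`. -/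
noncomputable def bigCoeff (Q : ℝ) (k : ℕ) : ℝ := (-1) ^ k * Q ^ k.choose 2 / qp Q Q k

theorem qp_succ (q a : ℝ) (k : ℕ) : qp q a (k + 1) = qp q a k * (1 - a * q ^ k) :=
  Finset.prod_range_succ _ _

theorem one_sub_pow_succ_pos {Q : ℝ} (h0 : 0 < Q) (h1 : Q < 1) (k : ℕ) : 0 < 1 - Q ^ (k + 1) :=
  sub_pos.2 (pow_lt_one₀ h0.le h1 k.succ_ne_zero)

theorem qp_self_pos {Q : ℝ} (h0 : 0 < Q) (h1 : Q < 1) (k : ℕ) : 0 < qp Q Q k :=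
  Finset.prod_pos fun i _ => by
    have := one_sub_pow_succ_pos h0 h1 i
    rwa [pow_succ'] at this

theorem smallCoeff_zero (Q : ℝ) : smallCoeff Q 0 = 1 := by simp [smallCoeff, qp]

theorem bigCoeff_zero (Q : ℝ) : bigCoeff Q 0 = 1 := by simp [bigCoeff, qp]

theorem smallCoeff_succ {Q : ℝ} (h0 : 0 < Q) (h1 : Q < 1) (k : ℕ) :
    (1 - Q ^ (k + 1)) * smallCoeff Q (k + 1) = smallCoeff Q k := by
  have h := one_sub_pow_succ_pos h0 h1 k
  have h' := qp_self_pos h0 h1 k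
  rw [smallCoeff, smallCoeff, qp_succ, ← pow_succ']
  field_simp

theorem bigCoeff_succ {Q : ℝ} (h0 : 0 < Q) (h1 : Q < 1) (k : ℕ) :
    (1 - Q ^ (k + 1)) * bigCoeff Q (k + 1) = -(Q ^ k * bigCoeff Q k) := by
  have h := one_sub_pow_succ_pos h0 h1 k
  have h' := qp_self_pos h0 h1 k
  rw [bigCoeff, bigCoeff, qp_succ, ← pow_succ', Nat.choose_succ_succ' k 1, Nat.choose_one_right,
    one_add_one_eq_two, pow_add Q k (k.choose 2), pow_succ (-1 : ℝ), div_eq_mul_inv, mul_inv]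
  field_simp

theorem tendsto_one_sub_pow_succ {Q : ℝ} (h0 : 0 < Q) (h1 : Q < 1) :
    Filter.Tendsto (fun k : ℕ => 1 - Q ^ (k + 1)) Filter.atTop (nhds 1) := by
  simpa using ((tendsto_pow_atTop_nhds_zero_of_lt_one h0.le h1).comp
    (Filter.tendsto_add_atTop_nat 1)).const_sub 1

theorem smallCoeff_pos {Q : ℝ} (h0 : 0 < Q) (h1 : Q < 1) (k : ℕ) : 0 < smallCoeff Q k :=
  one_div_pos.2 (qp_self_pos h0 h1 k)

theorem bigCoeff_ne_zero {Q : ℝ} (h0 : 0 < Q) (h1 : Q < 1) (k : ℕ) : bigCoeff Q k ≠ 0 :=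
  div_ne_zero (mul_ne_zero (pow_ne_zero _ (by norm_num)) (pow_ne_zero _ h0.ne'))
    (qp_self_pos h0 h1 k).ne'

theorem summable_smallCoeff {Q t : ℝ} (h0 : 0 < Q) (h1 : Q < 1) (ht0 : 0 < t) (ht1 : t < 1) :
    Summable fun k : ℕ => smallCoeff Q k * t ^ k := by
  refine summable_of_ratio_test_tendsto_lt_one ht1 (.of_forall fun k =>
    (mul_pos (smallCoeff_pos h0 h1 k) (pow_pos ht0 k)).ne') ?_
  have hlim := (tendsto_const_nhds (x := t)).div (tendsto_one_sub_pow_succ h0 h1) one_ne_zero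
  rw [div_one] at hlim
  refine hlim.congr fun k => ?_
  have h := one_sub_pow_succ_pos h0 h1 k
  have hs := smallCoeff_pos h0 h1 (k + 1)
  rw [← smallCoeff_succ h0 h1 k, ← norm_div, Real.norm_of_nonneg (by positivity), Pi.div_apply,
    pow_succ t]
  field_simp

theorem summable_bigCoeff {Q x : ℝ} (h0 : 0 < Q) (h1 : Q < 1) (hx : 0 < x) :
    Summable fun k : ℕ => bigCoeff Q k * x ^ k := by
  refine summable_of_ratio_test_tendsto_lt_one zero_lt_one (.of_forall fun k =>
    mul_ne_zero (bigCoeff_ne_zero h0 h1 k) (pow_pos hx k).ne') ?_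
  have hlim := ((tendsto_pow_atTop_nhds_zero_of_lt_one h0.le h1).mul_const x).div
    (tendsto_one_sub_pow_succ h0 h1) one_ne_zero
  rw [zero_mul, zero_div] at hlim
  refine hlim.congr fun k => ?_
  have h := one_sub_pow_succ_pos h0 h1 k
  have hb : bigCoeff Q (k + 1) = -(Q ^ k * bigCoeff Q k) / (1 - Q ^ (k + 1)) := by
    rw [← bigCoeff_succ h0 h1 k]
    field_simp
  have hbk := bigCoeff_ne_zero h0 h1 k
  have hr : bigCoeff Q (k + 1) * x ^ (k + 1) / (bigCoeff Q k * x ^ k) =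
      -(Q ^ k * x / (1 - Q ^ (k + 1))) := by
    rw [hb, pow_succ x]
    field_simp
  rw [← norm_div, hr, norm_neg, Real.norm_of_nonneg (by positivity), Pi.div_apply]

theorem tsum_bigCoeff_functional {Q x : ℝ} (h0 : 0 < Q) (h1 : Q < 1) (hx : 0 < x) :
    ∑' k, bigCoeff Q k * x ^ k = (1 - x) * ∑' k, bigCoeff Q k * (x * Q) ^ k := by
  have hs := summable_bigCoeff h0 h1 hx
  have hs' := summable_bigCoeff h0 h1 (mul_pos hx h0)
  have hd : ∑' k, (bigCoeff Q k * x ^ k - bigCoeff Q k * (x * Q) ^ k) =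
      -x * ∑' k, bigCoeff Q k * (x * Q) ^ k := by
    rw [(hs.sub hs').tsum_eq_zero_add, ← tsum_mul_left]
    simp only [pow_zero, sub_self, zero_add]
    refine tsum_congr fun k => ?_
    have h := bigCoeff_succ h0 h1 k
    rw [mul_pow, mul_pow]
    linear_combination x ^ (k + 1) * h
  rw [hs.tsum_sub hs'] at hd
  linear_combination hd

theorem tsum_bigCoeff_eq_qp_mul {Q x : ℝ} (h0 : 0 < Q) (h1 : Q < 1) (hx : 0 < x) (n : ℕ) :
    ∑' k, bigCoeff Q k * x ^ k = qp Q x n * ∑' k, bigCoeff Q k * (x * Q ^ n) ^ k := by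
  induction n with
  | zero => simp [qp]
  | succ n ih =>
    rw [ih, tsum_bigCoeff_functional h0 h1 (mul_pos hx (pow_pos h0 n)), qp_succ, pow_succ]
    ring_nf

theorem tendsto_qp {Q : ℝ} (h0 : 0 < Q) (h1 : Q < 1) (x : ℝ) :
    Filter.Tendsto (fun n => qp Q x n) Filter.atTop (nhds (qpInf Q x)) := by
  have hs : Summable fun i : ℕ => ‖-(x * Q ^ i)‖ :=
    (((summable_geometric_of_lt_one h0.le h1).mul_left x).neg).norm
  have hm := (multipliable_one_add_of_summable hs).hasProd.tendsto_prod_nat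
  simpa only [← sub_eq_add_neg, qp, qpInf] using hm

/-- Euler's expansion of `(x;Q)_∞`. -/
theorem hasSum_qpInf {Q x : ℝ} (h0 : 0 < Q) (h1 : Q < 1) (hx : 0 < x) :
    HasSum (fun k : ℕ => bigCoeff Q k * x ^ k) (qpInf Q x) := by
  have hs := summable_bigCoeff h0 h1 hx
  have hlim : Filter.Tendsto (fun n : ℕ => ∑' k, bigCoeff Q k * (x * Q ^ n) ^ k) Filter.atTop
      (nhds (∑' k, bigCoeff Q k * (0 : ℝ) ^ k)) := by
    refine tendsto_tsum_of_dominated_convergence hs.norm (fun k => ?_) (.of_forall fun n k => ?_)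
    · have := (tendsto_pow_atTop_nhds_zero_of_lt_one h0.le h1).const_mul x
      rw [mul_zero] at this
      exact (this.pow k).const_mul _
    · rw [norm_mul, norm_mul, norm_pow, norm_pow, norm_mul, norm_pow, Real.norm_of_nonneg hx.le,
        Real.norm_of_nonneg h0.le]
      gcongr
      exact mul_le_of_le_one_right hx.le (pow_le_one₀ h0.le h1.le)
  have hone : ∑' k, bigCoeff Q k * (0 : ℝ) ^ k = 1 := by
    rw [tsum_eq_single 0 fun k hk => by simp [hk]]
    simp [bigCoeff_zero]
  rw [hone] at hlim
  have hprod := (tendsto_qp h0 h1 x).mul hlim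
  rw [mul_one] at hprod
  rw [tendsto_nhds_unique hprod
    (tendsto_const_nhds.congr fun n => tsum_bigCoeff_eq_qp_mul h0 h1 hx n)]
  exact hs.hasSum

/-- The two Euler series are formal inverses of each other. -/
theorem sum_antidiagonal_smallCoeff_mul_bigCoeff {Q : ℝ} (h0 : 0 < Q) (h1 : Q < 1) (n : ℕ) :
    ∑ p ∈ Finset.HasAntidiagonal.antidiagonal (n + 1), smallCoeff Q p.1 * bigCoeff Q p.2 = 0 := by
  have key : ∀ n : ℕ, (1 - Q ^ (n + 1)) *
      ∑ p ∈ Finset.HasAntidiagonal.antidiagonal (n + 1), smallCoeff Q p.1 * bigCoeff Q p.2 =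
      (1 - Q ^ n) * ∑ p ∈ Finset.HasAntidiagonal.antidiagonal n, smallCoeff Q p.1 * bigCoeff Q p.2 := by
    intro n
    have hsplit : (1 - Q ^ (n + 1)) *
        ∑ p ∈ Finset.HasAntidiagonal.antidiagonal (n + 1), smallCoeff Q p.1 * bigCoeff Q p.2 =
        ∑ p ∈ Finset.HasAntidiagonal.antidiagonal (n + 1), (1 - Q ^ p.1) * smallCoeff Q p.1 * bigCoeff Q p.2 +
        ∑ p ∈ Finset.HasAntidiagonal.antidiagonal (n + 1),
          Q ^ p.1 * smallCoeff Q p.1 * ((1 - Q ^ p.2) * bigCoeff Q p.2) := by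
      rw [Finset.mul_sum, ← Finset.sum_add_distrib]
      refine Finset.sum_congr rfl fun p hp => ?_
      rw [← Finset.HasAntidiagonal.mem_antidiagonal.1 hp, pow_add]
      ring
    rw [hsplit, Finset.Nat.sum_antidiagonal_succ, Finset.Nat.sum_antidiagonal_succ']
    simp only [pow_zero, sub_self, zero_mul, mul_zero, zero_add]
    rw [Finset.mul_sum, ← Finset.sum_add_distrib]
    refine Finset.sum_congr rfl fun p hp => ?_
    rw [smallCoeff_succ h0 h1, bigCoeff_succ h0 h1, ← Finset.HasAntidiagonal.mem_antidiagonal.1 hp, pow_add]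
    ring
  induction n with
  | zero => simpa [(sub_pos.2 h1).ne'] using key 0
  | succ n ih =>
    have := key (n + 1)
    rw [ih, mul_zero] at this
    exact (mul_eq_zero.1 this).resolve_left (one_sub_pow_succ_pos h0 h1 (n + 1)).ne'

/-! ### Sequences on `ℤ` supported on `ℕ` -/

/-- Extension by zero of a sequence on `ℕ` to `ℤ`. -/
noncomputable def extendZero (a : ℕ → ℝ) (z : ℤ) : ℝ := if 0 ≤ z then a z.toNat else 0

theorem extendZero_natCast (a : ℕ → ℝ) (n : ℕ) : extendZero a n = a n := by simp [extendZero]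

theorem extendZero_of_neg (a : ℕ → ℝ) {z : ℤ} (hz : z < 0) : extendZero a z = 0 := by
  simp [extendZero, hz]

theorem notMem_range_natCast {z : ℤ} (hz : z ∉ Set.range ((↑) : ℕ → ℤ)) : z < 0 := by
  by_contra h
  exact hz ⟨z.toNat, Int.toNat_of_nonneg (not_lt.1 h)⟩

theorem summable_extendZero {a : ℕ → ℝ} (ha : Summable a) : Summable (extendZero a) := by
  refine (Nat.cast_injective.summable_iff fun z hz =>
    extendZero_of_neg a (notMem_range_natCast hz)).1 ?_
  simpa only [Function.comp_def, extendZero_natCast] using ha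

theorem tsum_extendZero_conv (a b : ℕ → ℝ)
    (hab : ∀ n, ∑ p ∈ Finset.HasAntidiagonal.antidiagonal (n + 1), a p.1 * b p.2 = 0) (h0 : a 0 * b 0 = 1) (n : ℤ) :
    ∑' i : ℤ, extendZero a (n - i) * extendZero b i = if n = 0 then 1 else 0 := by
  have hneg : ∀ i : ℤ, i ∉ Set.range ((↑) : ℕ → ℤ) → extendZero a (n - i) * extendZero b i = 0 :=
    fun i hi => by rw [extendZero_of_neg b (notMem_range_natCast hi), mul_zero]
  rw [← Nat.cast_injective.tsum_eq (f := fun i : ℤ => extendZero a (n - i) * extendZero b i)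
    (Function.support_subset_iff'.2 hneg)]
  rcases lt_or_ge n 0 with hn | hn
  · rw [if_neg hn.ne, ← tsum_zero (α := ℝ) (β := ℕ)]
    refine tsum_congr fun i => ?_
    rw [extendZero_of_neg a (by omega), zero_mul]
  · lift n to ℕ using hn
    rw [tsum_eq_sum (s := Finset.range (n + 1)) fun i hi => by
      rw [extendZero_of_neg a (by simp at hi; omega), zero_mul]]
    have hs : ∑ i ∈ Finset.range (n + 1), extendZero a ((n : ℤ) - (i : ℤ)) * extendZero b (i : ℤ) =
        ∑ p ∈ Finset.HasAntidiagonal.antidiagonal n, a p.1 * b p.2 := by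
      rw [← Finset.Nat.sum_antidiagonal_swap, Finset.Nat.sum_antidiagonal_eq_sum_range_succ_mk]
      refine Finset.sum_congr rfl fun i hi => ?_
      rw [← Nat.cast_sub (by simp at hi; omega), extendZero_natCast, extendZero_natCast]
      rfl
    rw [hs]
    cases n with
    | zero => simpa using h0
    | succ n => rw [hab, if_neg (by omega)]

/-! ### Correlations of summable sequences on `ℤ` -/

theorem summable_correlation_prod {α β : ℤ → ℝ} (hα : Summable α) (hβ : Summable β) (k : ℤ) :
    Summable fun p : ℤ × ℤ => α (k + p.1 + p.2) * β p.2 := by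
  have h := summable_mul_of_summable_norm hα.norm hβ.norm
  let e : ℤ × ℤ ≃ ℤ × ℤ :=
    { toFun := fun p => (k + p.1 + p.2, p.2)
      invFun := fun p => (p.1 - k - p.2, p.2)
      left_inv := fun p => Prod.ext (by dsimp only; ring) rfl
      right_inv := fun p => Prod.ext (by dsimp only; ring) rfl }
  exact e.summable_iff.2 h

theorem summable_correlation {α β κ : ℤ → ℝ} (hα : Summable α) (hβ : Summable β)
    (hκ : ∀ m, HasSum (fun i => α (m + i) * β i) (κ m)) : Summable κ := by
  have h := (summable_correlation_prod hα hβ 0).hasSum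
  refine (h.prod_fiberwise fun m => ?_).summable
  simpa using hκ m

/-- If `β` is the convolution inverse of `α`, their correlation is orthonormal to its
translates. -/
theorem hasSum_correlation_mul {α β κ : ℤ → ℝ} (hα : Summable α) (hβ : Summable β)
    (hκ : ∀ m, HasSum (fun i => α (m + i) * β i) (κ m))
    (hαβ : ∀ n, ∑' i, α (n - i) * β i = if n = 0 then 1 else 0) (k l : ℤ) :
    HasSum (fun n => κ (k + n) * κ (l + n)) (if k = l then 1 else 0) := by
  let T : ℤ × ℤ × ℤ → ℝ := fun p =>
    (α (k + p.1 + p.2.1) * β p.2.1) * (α (l + p.1 + p.2.2) * β p.2.2)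
  have hT : Summable T := by
    obtain ⟨C, hC⟩ : ∃ C, ∀ z, ‖α z‖ ≤ C :=
      ⟨∑' z, ‖α z‖, fun z => hα.norm.le_tsum z fun _ _ => norm_nonneg _⟩
    have h := summable_mul_of_summable_norm (summable_correlation_prod hα hβ k).norm hβ.norm
    have h' := (Equiv.prodAssoc ℤ ℤ ℤ).symm.summable_iff.2 h
    refine Summable.of_norm_bounded (h'.norm.mul_left C) fun p => ?_
    simp only [T, Function.comp_apply, Equiv.prodAssoc_symm_apply, norm_mul]
    calc _ = ‖α (l + p.1 + p.2.2)‖ *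
          (‖α (k + p.1 + p.2.1)‖ * ‖β p.2.1‖ * ‖β p.2.2‖) := by ring
      _ ≤ _ := by gcongr; exact hC _
  have hprod : ∀ u v : ℤ → ℝ, Summable u → Summable v → ∀ a b, HasSum u a → HasSum v b →
      HasSum (fun p : ℤ × ℤ => u p.1 * v p.2) (a * b) := fun u v hu hv a b ha hb =>
    ha.mul hb (summable_mul_of_summable_norm hu.norm hv.norm)
  have hsum : HasSum (fun n => κ (k + n) * κ (l + n)) (∑' p, T p) :=
    hT.hasSum.prod_fiberwise fun n =>
      hprod _ _ (hκ (k + n)).summable (hκ (l + n)).summable _ _ (hκ (k + n)) (hκ (l + n))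
  let e : ℤ × ℤ × ℤ ≃ ℤ × ℤ × ℤ :=
    { toFun := fun p => (p.1 - p.2.1 - p.2.2, p.2)
      invFun := fun p => (p.1 + p.2.1 + p.2.2, p.2)
      left_inv := fun p => Prod.ext (by dsimp only; ring) rfl
      right_inv := fun p => Prod.ext (by dsimp only; ring) rfl }
  have hconv : ∀ n, HasSum (fun i => α (n - i) * β i) (if n = 0 then 1 else 0) := by
    intro n
    rw [← hαβ n]
    refine Summable.hasSum ?_
    obtain ⟨C, hC⟩ : ∃ C, ∀ z, ‖α z‖ ≤ C :=
      ⟨∑' z, ‖α z‖, fun z => hα.norm.le_tsum z fun _ _ => norm_nonneg _⟩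
    refine Summable.of_norm_bounded (hβ.norm.mul_left C) fun i => ?_
    rw [norm_mul]
    gcongr
    exact hC _
  have hfib : HasSum (fun n : ℤ => (if l + n = 0 then (1 : ℝ) else 0) * if k + n = 0 then 1 else 0)
      (∑' p, T p) := by
    refine (e.hasSum_iff.2 hT.hasSum).prod_fiberwise fun n => ?_
    have h := hprod _ _ (hconv (l + n)).summable (hconv (k + n)).summable _ _
      (hconv (l + n)) (hconv (k + n))
    refine HasSum.congr_fun h fun p => ?_
    simp only [T, e, Function.comp_apply, Equiv.coe_fn_mk]
    rw [show k + (n - p.1 - p.2) + p.1 = k + n - p.2 by ring,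
      show l + (n - p.1 - p.2) + p.2 = l + n - p.1 by ring]
    ring
  have hdelta : HasSum
      (fun n : ℤ => (if l + n = 0 then (1 : ℝ) else 0) * if k + n = 0 then 1 else 0)
      (if k = l then 1 else 0) := by
    convert hasSum_single (-k)
      (f := fun n : ℤ => (if l + n = 0 then (1 : ℝ) else 0) * if k + n = 0 then 1 else 0) ?_ using 1
    · simp only [add_neg_cancel, if_true, mul_one]
      exact if_congr (by omega) rfl rfl
    · intro n hn
      rw [if_neg (show ¬ k + n = 0 by omega), mul_zero]
  rwa [hfib.unique hdelta] at hsum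

/-- A summable Hankel kernel with orthonormal rows is an involution on bounded sequences. -/
theorem hankel_involution {κ : ℤ → ℝ} (hκ : Summable κ)
    (horth : ∀ k l, HasSum (fun n => κ (k + n) * κ (l + n)) (if k = l then 1 else 0))
    {F G : ℤ → ℝ} {C : ℝ} (hF : ∀ l, ‖F l‖ ≤ C)
    (hG : ∀ n, HasSum (fun l => κ (l + n) * F l) (G n)) (k : ℤ) :
    HasSum (fun n => κ (k + n) * G n) (F k) := by
  let T : ℤ × ℤ → ℝ := fun p => κ (k + p.1) * (κ (p.2 + p.1) * F p.2)
  have hT : Summable T := by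
    have h := summable_mul_of_summable_norm hκ.norm hκ.norm
    let e : ℤ × ℤ ≃ ℤ × ℤ :=
      { toFun := fun p => (k + p.1, p.2 + p.1)
        invFun := fun p => (p.1 - k, p.2 - (p.1 - k))
        left_inv := fun p => by ext <;> simp
        right_inv := fun p => by ext <;> simp }
    refine Summable.of_norm_bounded ((e.summable_iff.2 h).norm.mul_left C) fun p => ?_
    simp only [T, e, Function.comp_apply, Equiv.coe_fn_mk, norm_mul]
    calc _ = ‖F p.2‖ * (‖κ (k + p.1)‖ * ‖κ (p.2 + p.1)‖) := by ring
      _ ≤ _ := by gcongr; exact hF _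
  have hsum : HasSum (fun n => κ (k + n) * G n) (∑' p, T p) :=
    hT.hasSum.prod_fiberwise fun n => (hG n).mul_left _
  have hswap : HasSum (fun l => (if k = l then 1 else 0) * F l) (∑' p, T p) := by
    refine ((Equiv.prodComm ℤ ℤ).hasSum_iff.2 hT.hasSum).prod_fiberwise fun l => ?_
    refine HasSum.congr_fun ((horth k l).mul_right (F l)) fun n => ?_
    simp only [T, Function.comp_apply, Equiv.prodComm_apply, Prod.swap_prod_mk, mul_assoc]
  have hdelta : HasSum (fun l => (if k = l then 1 else 0) * F l) (F k) := by
    convert hasSum_single k (f := fun l => (if k = l then 1 else 0) * F l) ?_ using 1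
    · simp
    · intro l hl
      rw [if_neg hl.symm, zero_mul]
  rwa [hswap.unique hdelta] at hsum

/-! ### The q-Bessel kernel as a correlation -/

theorem qpInf_self_ne_zero {Q : ℝ} (h0 : 0 < Q) (h1 : Q < 1) : qpInf Q Q ≠ 0 := by
  have h := tsum_mul_tsum_eq_tsum_sum_antidiagonal_of_summable_norm
    (summable_smallCoeff h0 h1 h0 h1).norm (summable_bigCoeff h0 h1 h0).norm
  have hone : ∑' n, ∑ p ∈ Finset.HasAntidiagonal.antidiagonal n,
      smallCoeff Q p.1 * Q ^ p.1 * (bigCoeff Q p.2 * Q ^ p.2) = 1 := by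
    rw [tsum_eq_single 0]
    · simp [smallCoeff_zero, bigCoeff_zero]
    · intro n hn
      obtain ⟨n, rfl⟩ := Nat.exists_eq_succ_of_ne_zero hn
      rw [← zero_mul (Q ^ (n + 1)), ← sum_antidiagonal_smallCoeff_mul_bigCoeff h0 h1 n,
        Finset.sum_mul]
      refine Finset.sum_congr rfl fun p hp => ?_
      rw [← Finset.HasAntidiagonal.mem_antidiagonal.1 hp, pow_add]
      ring
  rw [hone, (hasSum_qpInf h0 h1 h0).tsum_eq] at h
  exact right_ne_zero_of_mul_eq_one h

theorem qpInf_eq_qp_mul {Q x : ℝ} (h0 : 0 < Q) (h1 : Q < 1) (hx : 0 < x) (n : ℕ) :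
    qpInf Q x = qp Q x n * qpInf Q (x * Q ^ n) := by
  rw [← (hasSum_qpInf h0 h1 hx).tsum_eq,
    ← (hasSum_qpInf h0 h1 (mul_pos hx (pow_pos h0 n))).tsum_eq]
  exact tsum_bigCoeff_eq_qp_mul h0 h1 hx n

theorem qpInf_zpow_div {Q : ℝ} (h0 : 0 < Q) (h1 : Q < 1) (m : ℤ) :
    qpInf Q (Q ^ (m + 1)) / qpInf Q Q = extendZero (smallCoeff Q) m := by
  have hne := qpInf_self_ne_zero h0 h1
  cases m with
  | ofNat n =>
    have h := qpInf_eq_qp_mul h0 h1 h0 n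
    have hp := qp_self_pos h0 h1 n
    have hz : Q ^ ((n : ℤ) + 1) = Q * Q ^ n := by
      rw [← pow_succ']
      exact_mod_cast rfl
    rw [Int.ofNat_eq_natCast, extendZero_natCast, smallCoeff, hz,
      div_eq_div_iff hne hp.ne', one_mul, h, mul_comm]
  | negSucc n =>
    have hfac : qp Q (Q ^ (Int.negSucc n + 1)) (n + 1) = 0 := by
      rw [qp_succ, show Int.negSucc n + 1 = -(n : ℤ) by omega, zpow_neg, zpow_natCast,
        inv_mul_cancel₀ (pow_pos h0 n).ne', sub_self, mul_zero]
    rw [extendZero_of_neg _ (Int.negSucc_lt_zero n),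
      qpInf_eq_qp_mul h0 h1 (zpow_pos h0 _) (n + 1), hfac, zero_mul, zero_div]

theorem extendZero_mul_pow (a : ℕ → ℝ) (t : ℝ) (z : ℤ) :
    extendZero (fun n => a n * t ^ n) z = extendZero a z * t ^ z := by
  rcases lt_or_ge z 0 with hz | hz
  · rw [extendZero_of_neg _ hz, extendZero_of_neg _ hz, zero_mul]
  · lift z to ℕ using hz
    rw [extendZero_natCast, extendZero_natCast, zpow_natCast]

/-- The two expansions of `Σ_k b_k z^k (w Q^k;Q)_∞ = Σ_j b_j w^j (z Q^j;Q)_∞`, where `b` are the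
coefficients of Euler's series. -/
theorem exists_hasSum_bigCoeff_mul_qpInf {Q w z : ℝ} (h0 : 0 < Q) (h1 : Q < 1) (hw : 0 < w)
    (hz : 0 < z) :
    ∃ S, HasSum (fun k : ℕ => bigCoeff Q k * z ^ k * qpInf Q (w * Q ^ k)) S ∧
      HasSum (fun j : ℕ => bigCoeff Q j * w ^ j * qpInf Q (z * Q ^ j)) S := by
  let T : ℕ × ℕ → ℝ := fun p =>
    bigCoeff Q p.1 * z ^ p.1 * (bigCoeff Q p.2 * w ^ p.2) * Q ^ (p.1 * p.2)
  have hT : Summable T := by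
    have h := summable_mul_of_summable_norm (summable_bigCoeff h0 h1 hz).norm
      (summable_bigCoeff h0 h1 hw).norm
    refine Summable.of_norm_bounded h.norm fun p => ?_
    rw [norm_mul _ (Q ^ (p.1 * p.2)), Real.norm_of_nonneg (pow_nonneg h0.le _)]
    exact mul_le_of_le_one_right (norm_nonneg _) (pow_le_one₀ h0.le h1.le)
  refine ⟨∑' p, T p, hT.hasSum.prod_fiberwise fun k => ?_,
    ((Equiv.prodComm ℕ ℕ).hasSum_iff.2 hT.hasSum).prod_fiberwise fun j => ?_⟩
  · refine HasSum.congr_fun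
      ((hasSum_qpInf h0 h1 (mul_pos hw (pow_pos h0 k))).mul_left (bigCoeff Q k * z ^ k)) fun j => ?_
    simp only [T, mul_pow, pow_mul]
    ring
  · refine HasSum.congr_fun
      ((hasSum_qpInf h0 h1 (mul_pos hz (pow_pos h0 j))).mul_left (bigCoeff Q j * w ^ j)) fun k => ?_
    simp only [T, Function.comp_apply, Equiv.prodComm_apply, Prod.swap_prod_mk, mul_pow,
      pow_mul]
    ring

theorem Jr_term_eq {q : ℝ} (hq0 : 0 < q) (ν : ℝ) (m : ℤ) (k : ℕ) :
    (-1) ^ k * q ^ (k * (k - 1)) * (q ^ 2 * (q ^ m) ^ 2) ^ k *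
      qpInf (q ^ 2) (q ^ (2 * ν + 2 + 2 * (k : ℝ))) / qp (q ^ 2) (q ^ 2) k =
    bigCoeff (q ^ 2) k * ((q ^ 2) ^ (m + 1)) ^ k *
      qpInf (q ^ 2) ((q ^ (ν + 1)) ^ 2 * (q ^ 2) ^ k) := by
  have hchoose : (q ^ 2) ^ k.choose 2 = q ^ (k * (k - 1)) := by
    rw [← pow_mul, Nat.choose_two_right, Nat.mul_div_cancel' (Nat.even_mul_pred_self k).two_dvd]
  have harg : q ^ (2 * ν + 2 + 2 * (k : ℝ)) = (q ^ (ν + 1)) ^ 2 * (q ^ 2) ^ k := by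
    rw [← pow_mul, ← Real.rpow_natCast, ← Real.rpow_natCast, ← Real.rpow_mul hq0.le,
      ← Real.rpow_add hq0]
    congr 1
    push_cast
    ring
  have hz : (q ^ 2) ^ (m + 1) = q ^ 2 * (q ^ m) ^ 2 := by
    rw [zpow_add_one₀ (pow_pos hq0 2).ne', ← zpow_natCast q 2, ← zpow_mul, mul_comm _ m, zpow_mul,
      zpow_natCast, zpow_natCast, mul_comm]
  rw [harg, hz, bigCoeff, hchoose]
  ring

theorem hasSum_qBessel {q ν : ℝ} (hq0 : 0 < q) (hq1 : q < 1) (m : ℤ) :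
    HasSum (fun i : ℤ => extendZero (fun n => smallCoeff (q ^ 2) n * (q ^ (ν + 1)) ^ n) (m + i) *
      extendZero (fun n => bigCoeff (q ^ 2) n * (q ^ (ν + 1)) ^ n) i)
      (q ^ m * Jr q ν (q ^ m)) := by
  have hQ0 : 0 < q ^ 2 := pow_pos hq0 2
  have hQ1 : q ^ 2 < 1 := pow_lt_one₀ hq0.le hq1 two_ne_zero
  have ht0 : 0 < q ^ (ν + 1) := Real.rpow_pos_of_pos hq0 _
  obtain ⟨S, hS, hS'⟩ := exists_hasSum_bigCoeff_mul_qpInf hQ0 hQ1 (pow_pos ht0 2)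
    (zpow_pos hQ0 (m + 1))
  have hpow : q ^ m * (q ^ m) ^ ν = (q ^ (ν + 1)) ^ m := by
    rw [← Real.rpow_intCast, ← Real.rpow_intCast, ← Real.rpow_mul hq0.le, ← Real.rpow_mul hq0.le,
      ← Real.rpow_add hq0]
    congr 1
    ring
  have hJ : q ^ m * Jr q ν (q ^ m) = (q ^ (ν + 1)) ^ m / qpInf (q ^ 2) (q ^ 2) * S := by
    rw [Jr, tsum_congr (Jr_term_eq hq0 ν m), hS.tsum_eq, ← hpow]
    ring
  rw [hJ, ← Nat.cast_injective.hasSum_iff fun i hi => by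
    rw [extendZero_of_neg _ (notMem_range_natCast hi), mul_zero]]
  refine HasSum.congr_fun (hS'.mul_left ((q ^ (ν + 1)) ^ m / qpInf (q ^ 2) (q ^ 2))) fun j => ?_
  rw [Function.comp_apply, extendZero_mul_pow, extendZero_natCast, ← qpInf_zpow_div hQ0 hQ1,
    zpow_add₀ ht0.ne', zpow_natCast, ← zpow_natCast (q ^ 2) j, ← zpow_add₀ hQ0.ne',
    show m + 1 + (j : ℤ) = m + j + 1 by ring]
  ring

/-- the q-Hankel transform with kernel `J_ν` is self-inverse on
square-summable functions on `q^ℤ`: if `g(q^n) = Σ_k q^{2k} J_ν(q^{k+n};q²) f(q^k)`,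
then `f(q^k) = Σ_n q^{2n} J_ν(q^{k+n};q²) g(q^n)`. -/
theorem qHankel_self_inverse (q ν : ℝ) (hq0 : 0 < q) (hq1 : q < 1) (hν : -1 < ν)
    (f g : ℤ → ℝ)
    (hf : Summable fun k : ℤ => q ^ (2 * k) * (f k) ^ 2)
    (hg : ∀ n : ℤ, HasSum (fun k : ℤ => q ^ (2 * k) * Jr q ν (q ^ (k + n)) * f k) (g n)) :
    ∀ k : ℤ, HasSum (fun n : ℤ => q ^ (2 * n) * Jr q ν (q ^ (k + n)) * g n) (f k) := by
  have hQ0 : 0 < q ^ 2 := pow_pos hq0 2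
  have hQ1 : q ^ 2 < 1 := pow_lt_one₀ hq0.le hq1 two_ne_zero
  have ht0 : 0 < q ^ (ν + 1) := Real.rpow_pos_of_pos hq0 _
  have ht1 : q ^ (ν + 1) < 1 := Real.rpow_lt_one hq0.le hq1 (by linarith)
  have hα := summable_extendZero (summable_smallCoeff hQ0 hQ1 ht0 ht1)
  have hβ := summable_extendZero (summable_bigCoeff hQ0 hQ1 ht0)
  let κ : ℤ → ℝ := fun m => q ^ m * Jr q ν (q ^ m)
  have hκ : ∀ m, HasSum _ (κ m) := hasSum_qBessel hq0 hq1
  have hconv := tsum_extendZero_conv (fun n => smallCoeff (q ^ 2) n * (q ^ (ν + 1)) ^ n)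
    (fun n => bigCoeff (q ^ 2) n * (q ^ (ν + 1)) ^ n) (fun n => by
      have h := sum_antidiagonal_smallCoeff_mul_bigCoeff hQ0 hQ1 n
      rw [← zero_mul ((q ^ (ν + 1)) ^ (n + 1)), ← h, Finset.sum_mul]
      refine Finset.sum_congr rfl fun p hp => ?_
      rw [← Finset.HasAntidiagonal.mem_antidiagonal.1 hp, pow_add]
      ring) (by simp [smallCoeff_zero, bigCoeff_zero])
  have hκ_sum : Summable κ := summable_correlation hα hβ hκ
  have horth := hasSum_correlation_mul hα hβ hκ hconv
  let F : ℤ → ℝ := fun k => q ^ k * f k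
  have hF : ∀ k : ℤ, ‖F k‖ ≤ √(∑' k : ℤ, q ^ (2 * k) * (f k) ^ 2) := fun k => by
    refine Real.le_sqrt_of_sq_le ?_
    have h := hf.le_tsum k fun i _ => by positivity
    rwa [mul_comm 2 k, zpow_mul, zpow_ofNat, ← mul_pow, ← sq_abs, ← Real.norm_eq_abs] at h
  have hpow : ∀ a b : ℤ, q ^ (a + b) = q ^ a * q ^ b := fun a b => zpow_add₀ hq0.ne' a b
  have hne : ∀ a : ℤ, q ^ a ≠ 0 := fun a => zpow_ne_zero a hq0.ne'
  have hG : ∀ n : ℤ, HasSum (fun l => κ (l + n) * F l) (q ^ n * g n) := fun n => by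
    refine HasSum.congr_fun ((hg n).mul_left (q ^ n)) fun l => ?_
    simp only [κ, F]
    rw [two_mul, hpow l l, hpow l n]
    ring
  intro k
  have h := hankel_involution hκ_sum horth hF hG k
  have h' := h.mul_left (q ^ k)⁻¹
  rw [inv_mul_cancel_left₀ (hne k)] at h'
  refine HasSum.congr_fun h' fun n => ?_
  simp only [κ]
  rw [two_mul, hpow n n, hpow k n]
  field_simp [hne k]
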